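/- For every real c with 0 < c < 1/6, Container of strength q = 3 has a winning strategy in the containment game on Z_strong with spreading function g(t) = ⌈c·√t⌉, for every finite initial occupied set; in particular 3 ∈ q(Z_strong, t ↦ ⌈c·t^{1/2}⌉). -/

import Mathlib

open Set

/-- The number of vertices Container of strength `q` may delete at turn `t`:
`⌊t·q⌋ − ⌊(t−1)·q⌋`. -/
noncomputable def budget (q : ℝ) (t : ℕ) : ℕ :=
  (⌊(t : ℝ) * q⌋ - ⌊((t : ℝ) - 1) * q⌋).toNat

/-- The cumulative deleted sets determined by a Container strategy `σ`
(mapping the history `[B 0, …, B t]` of occupied sets to the set of vertices deleted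
at turn `t + 1`) against the occupied sets `B`. -/
def delSets {V : Type*} (σ : List (Set V) → Set V) (B : ℕ → Set V) : ℕ → Set V
  | 0 => ∅
  | t + 1 => delSets σ B t ∪ σ ((List.range (t + 1)).map B)

/-- Spreader's moves are legal with spread function `g` against cumulative deleted
sets `F`: occupied sets increase, at most `g (t + 1)` vertices are newly occupied at
turn `t + 1`, and each newly occupied vertex is undeleted and adjacent (with respect
to `adj`) to a previously occupied vertex. -/
def SpreaderLegal {V : Type*} (adj : V → V → Prop) (g : ℕ → ℕ∞)
    (F B : ℕ → Set V) : Prop :=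
  ∀ t : ℕ,
    B t ⊆ B (t + 1) ∧
    (B (t + 1) \ B t).encard ≤ g (t + 1) ∧
    ∀ v ∈ B (t + 1) \ B t, v ∉ F (t + 1) ∧ ∃ u ∈ B t, adj u v

/-- The Container strategy `σ` plays legally along occupied sets `B`: at every turn it
deletes only unoccupied vertices, and at most the budget of them. -/
def ContainerLegal {V : Type*} (q : ℝ) (σ : List (Set V) → Set V)
    (B : ℕ → Set V) : Prop :=
  ∀ t : ℕ,
    σ ((List.range (t + 1)).map B) ∩ B t = ∅ ∧
    (σ ((List.range (t + 1)).map B)).encard ≤ (budget q (t + 1) : ℕ∞)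

/-- Container of strength `q` wins the containment game on the graph `adj` with spread
function `g` and initial occupied set `B₀`, deleting only vertices of `A`: it has a
strategy which, against every legal Spreader play, is itself legal, deletes only
vertices of `A`, and forces the occupied set to eventually stabilize. -/
def ContainerWinsIn {V : Type*} (adj : V → V → Prop) (q : ℝ) (g : ℕ → ℕ∞)
    (B₀ : Set V) (A : Set V) : Prop :=
  ∃ σ : List (Set V) → Set V,
    ∀ B : ℕ → Set V, B 0 = B₀ → SpreaderLegal adj g (delSets σ B) B →
      ContainerLegal q σ B ∧
      (∀ t : ℕ, σ ((List.range (t + 1)).map B) ⊆ A) ∧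
      ∃ T : ℕ, ∀ t : ℕ, T ≤ t → B t = B T

/-- Container of strength `q` wins the containment game `(adj, q, g)` with initial
occupied set `B₀`. -/
def ContainerWins {V : Type*} (adj : V → V → Prop) (q : ℝ) (g : ℕ → ℕ∞)
    (B₀ : Set V) : Prop :=
  ContainerWinsIn adj q g B₀ Set.univ

/-- `q(G, g)`: the set of strengths `q > 0` for which Container wins the containment
game `(adj, q, g)` from every finite initial occupied set. -/
def qSet {V : Type*} (adj : V → V → Prop) (g : ℕ → ℕ∞) : Set ℝ :=
  {q | 0 < q ∧ ∀ B₀ : Set V, B₀.Finite → ContainerWins adj q g B₀}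

/-- The occupied sets determined by a Spreader strategy `τ` (mapping the history
`[F 1, …, F (t + 1)]` of cumulative deleted sets to the set of vertices newly occupied
at turn `t + 1`) against deleted sets `F`, starting from `B₀`. -/
def occSets {V : Type*} (τ : List (Set V) → Set V) (B₀ : Set V)
    (F : ℕ → Set V) : ℕ → Set V
  | 0 => B₀
  | t + 1 => occSets τ B₀ F t ∪ τ ((List.range (t + 1)).map fun i => F (i + 1))

/-- The sequence `F` of cumulative deleted sets is a legal play of Container of
strength `q` against occupied sets `B`. -/
def ContainerSeqLegal {V : Type*} (q : ℝ) (F B : ℕ → Set V) : Prop :=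
  F 0 = ∅ ∧ ∀ t : ℕ,
    F t ⊆ F (t + 1) ∧
    (F (t + 1) \ F t).encard ≤ (budget q (t + 1) : ℕ∞) ∧
    (F (t + 1) \ F t) ∩ B t = ∅

/-- Spreader wins the containment game `(adj, q, g)` with initial occupied set `B₀`:
it has a strategy which, against every legal Container play, is itself legal and
occupies new vertices at arbitrarily late times. -/
def SpreaderWins {V : Type*} (adj : V → V → Prop) (q : ℝ) (g : ℕ → ℕ∞)
    (B₀ : Set V) : Prop :=
  ∃ τ : List (Set V) → Set V,
    ∀ F : ℕ → Set V, ContainerSeqLegal q F (occSets τ B₀ F) →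
      SpreaderLegal adj g F (occSets τ B₀ F) ∧
      ∀ T : ℕ, ∃ t : ℕ, T ≤ t ∧ occSets τ B₀ F t ≠ occSets τ B₀ F T

/-- The strongly connected grid `ℤ ⊠ ℤ`. -/
def adjStrong (p q : ℤ × ℤ) : Prop :=
  max |p.1 - q.1| |p.2 - q.2| = 1

/-- The vertices of the eighth plane: `{(x, y) ∈ ℤ² : 0 ≤ x ≤ y}`. -/
abbrev ZEighth : Type := {p : ℤ × ℤ // 0 ≤ p.1 ∧ p.1 ≤ p.2}

/-- The edges of the eighth plane: `(x, y) ~ (x + i, y + 1)` for `i ∈ {0, 1}`. -/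
def adjEighth (p q : ZEighth) : Prop :=
  (q.val.2 = p.val.2 + 1 ∧ (q.val.1 = p.val.1 ∨ q.val.1 = p.val.1 + 1)) ∨
  (p.val.2 = q.val.2 + 1 ∧ (p.val.1 = q.val.1 ∨ p.val.1 = q.val.1 + 1))

set_option linter.unusedSimpArgs false

/-- Reachability facts of a fire. -/
structure Fire (ρ : ℕ) (B : ℕ → Set (ℤ × ℤ)) : Prop where
  init : ∀ v ∈ B 0, |v.1| ≤ (ρ : ℤ) ∧ |v.2| ≤ (ρ : ℤ)
  mono : ∀ t, B t ⊆ B (t + 1)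
  step : ∀ t, ∀ v ∈ B (t + 1), v ∉ B t → ∃ u ∈ B t, |v.1 - u.1| ≤ 1 ∧ |v.2 - u.2| ≤ 1

theorem Fire.monotone {ρ : ℕ} {B : ℕ → Set (ℤ × ℤ)} (hF : Fire ρ B) : Monotone B :=
  monotone_nat_of_le_succ hF.mono

theorem Fire.reach {ρ : ℕ} {B : ℕ → Set (ℤ × ℤ)} (hF : Fire ρ B) (t : ℕ) :
    ∀ v ∈ B t, |v.1| ≤ (ρ : ℤ) + t ∧ |v.2| ≤ (ρ : ℤ) + t := by
  induction t with
  | zero => intro v hv; simpa using hF.init v hv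
  | succ t ih =>
    intro v hv
    by_cases h : v ∈ B t
    · have := ih v h
      push_cast
      omega
    · obtain ⟨u, hu, h1, h2⟩ := hF.step t v hv h
      have := ih u hu
      push_cast
      (simp only [abs_le, lt_abs] at *; omega)

theorem Fire.cross {ρ : ℕ} {B : ℕ → Set (ℤ × ℤ)} (hF : Fire ρ B) (x0 : ℤ) (hx : (ρ : ℤ) < x0)
    (t : ℕ) : ∀ v ∈ B t, x0 ≤ v.1 → ∃ (t' : ℕ), ∃ u ∈ B t', u.1 = x0 ∧
      (t' : ℤ) + (v.1 - x0) ≤ t ∧ |v.2 - u.2| ≤ (t : ℤ) - t' := by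
  induction t with
  | zero =>
    intro v hv h
    have := (hF.init v hv).1
    (simp only [abs_le, lt_abs] at *; omega)
  | succ t ih =>
    intro v hv hvx
    by_cases h : v ∈ B t
    · obtain ⟨t', u, hu, h1, h2, h3⟩ := ih v h hvx
      exact ⟨t', u, hu, h1, by push_cast; omega, by push_cast; omega⟩
    · obtain ⟨u, hu, h1, h2⟩ := hF.step t v hv h
      by_cases hux : x0 ≤ u.1
      · obtain ⟨t', w, hw, g1, g2, g3⟩ := ih u hu hux
        exact ⟨t', w, hw, g1, by push_cast; (simp only [abs_le, lt_abs] at *; omega), by push_cast; (simp only [abs_le, lt_abs] at *; omega)⟩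
      · exact ⟨t + 1, v, hv, by (simp only [abs_le, lt_abs] at *; omega), by push_cast; (simp only [abs_le, lt_abs] at *; omega), by simp⟩

theorem Fire.reflect {ρ : ℕ} {B : ℕ → Set (ℤ × ℤ)} (hF : Fire ρ B) :
    Fire ρ (fun t => {p | (-p.1, p.2) ∈ B t}) where
  init := by
    intro v hv
    have := hF.init _ hv
    simpa using this
  mono := fun t v hv => hF.mono t hv
  step := by
    intro t v hv hn
    obtain ⟨u, hu, h1, h2⟩ := hF.step t _ hv hn
    refine ⟨(-u.1, u.2), by simpa using hu, ?_, ?_⟩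
    · simp only at h1 ⊢
      (simp only [abs_le, lt_abs] at *; omega)
    · simpa using h2

/-- The holes `H` cannot be reached in time, judging from the occupied set `F` at turn `t1`. -/
def Good (ρ t1 K s : ℕ) (F : Set (ℤ × ℤ)) (H : Finset ℤ) : Prop :=
  ∃ x0 : ℤ, (ρ : ℤ) + t1 - 2 * s + 1 ≤ x0 ∧ x0 ≤ (ρ : ℤ) + t1 - s ∧
    ∀ y ∈ H, ∀ u ∈ F, u.1 = x0 → (K : ℤ) + 3 * s < |y - u.2|

theorem good_safe {ρ t1 K s : ℕ} {B : ℕ → Set (ℤ × ℤ)} (hF : Fire ρ B) (hs : 2 * s ≤ t1)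
    {H : Finset ℤ} (hG : Good ρ t1 K s (B t1) H) {y : ℤ} (hy : y ∈ H) {t : ℕ}
    (ht : t < t1 + K + s) : (((ρ + t1 + K : ℕ) : ℤ), y) ∉ B t := by
  intro hv
  obtain ⟨x0, h1, h2, h3⟩ := hG
  obtain ⟨t', u, hu, g1, g2, g3⟩ := hF.cross x0 (by omega) t _ hv (by push_cast; omega)
  simp only at g2 g3
  have hu1 : u ∈ B t1 := hF.monotone (show t' ≤ t1 by push_cast at g2; omega) hu
  have := h3 y hy u hu1 g1
  have h5 := (hF.reach t' u hu).1
  (simp only [abs_le, lt_abs] at *; omega)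

theorem window_count {ρ : ℕ} {B : ℕ → Set (ℤ × ℤ)} (hF : Fire ρ B) (t0 G : ℕ) (k : ℕ)
    (hg : ∀ t < t0 + k, (B (t + 1) \ B t).encard ≤ G) :
    {v ∈ B (t0 + k) | (ρ : ℤ) + t0 + 1 ≤ v.1}.encard ≤ (k * G : ℕ) := by
  induction k with
  | zero =>
    have : {v ∈ B (t0 + 0) | (ρ : ℤ) + t0 + 1 ≤ v.1} = ∅ := by
      ext v
      simp only [Set.mem_ofPred_eq, Set.mem_empty_iff_false, iff_false, not_and]
      intro hv
      have := (hF.reach _ v hv).1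
      push_cast at this
      (simp only [abs_le, lt_abs] at *; omega)
    rw [this]; simp
  | succ k ih =>
    have h1 := ih (fun t ht => hg t (by omega))
    have h2 := hg (t0 + k) (by omega)
    have : {v ∈ B (t0 + (k + 1)) | (ρ : ℤ) + t0 + 1 ≤ v.1} ⊆
        {v ∈ B (t0 + k) | (ρ : ℤ) + t0 + 1 ≤ v.1} ∪ (B (t0 + k + 1) \ B (t0 + k)) := by
      rintro v ⟨hv, hx⟩
      by_cases h : v ∈ B (t0 + k)
      · exact Or.inl ⟨h, hx⟩
      · exact Or.inr ⟨hv, h⟩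
    calc _ ≤ _ := Set.encard_le_encard this
      _ ≤ _ := Set.encard_union_le _ _
      _ ≤ ((k * G : ℕ) : ℕ∞) + G := add_le_add h1 h2
      _ = _ := by push_cast; ring

theorem good_exists {ρ t1 K s G : ℕ} {B : ℕ → Set (ℤ × ℤ)} (hF : Fire ρ B) (hs : 2 * s ≤ t1)
    (hs0 : 0 < s) (hg : ∀ t < t1, (B (t + 1) \ B t).encard ≤ G) (hGK : 2 * G ≤ K)
    (U : Finset ℤ) (hU : U.card = K + 2 * s)
    (hsp : ∀ y ∈ U, ∀ z ∈ U, |y - z| ≤ 2 * ((K : ℤ) + 3 * s) → y = z) :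
    ∃ H ⊆ U, H.card = 2 * s ∧ Good ρ t1 K s (B t1) H := by
  classical
  have hc := window_count hF (t1 - 2 * s) G (2 * s) (fun t ht => hg t (by omega))
  rw [Nat.sub_add_cancel hs] at hc
  set S := {v ∈ B t1 | (ρ : ℤ) + (t1 - 2 * s : ℕ) + 1 ≤ v.1} with hS
  have hfin : S.Finite := Set.finite_of_encard_le_coe hc
  have hcard : hfin.toFinset.card ≤ 2 * s * G := by
    rw [hfin.encard_eq_coe_toFinset_card] at hc
    exact_mod_cast hc
  set I := Finset.Icc ((ρ : ℤ) + t1 - 2 * s + 1) ((ρ : ℤ) + t1 - s) with hI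
  have hIc : I.card = s := by
    rw [hI, Int.card_Icc]; omega
  set S' := hfin.toFinset.filter (fun v => v.1 ∈ I)
  have hS' : S'.card ≤ I.card * (2 * G) := by
    rw [hIc]
    calc _ ≤ _ := Finset.card_filter_le _ _
      _ ≤ _ := hcard
      _ = _ := by ring
  obtain ⟨x0, hx0, hcol⟩ := Finset.exists_card_fiber_le_of_card_le_mul (f := fun v : ℤ × ℤ => v.1)
    (Finset.card_pos.mp (by omega)) hS'
  set C := {x ∈ S' | x.1 = x0} with hC
  set X := U.filter (fun y => ∃ u ∈ C, |y - u.2| ≤ (K : ℤ) + 3 * s) with hX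
  have hXc : X.card ≤ C.card := by
    have hch : ∀ y ∈ X, ∃ u ∈ C, |y - u.2| ≤ (K : ℤ) + 3 * s := fun y hy =>
      (Finset.mem_filter.mp hy).2
    choose! f hf hf' using hch
    refine Finset.card_le_card_of_injOn f hf ?_
    intro y hy z hz hyz
    have h1 := hf' y hy
    have h2 := hf' z hz
    rw [hyz] at h1
    exact hsp y (Finset.mem_filter.mp hy).1 z (Finset.mem_filter.mp hz).1 (by (simp only [abs_le, lt_abs] at *; omega))
  have hle : 2 * s ≤ (U \ X).card := by
    have := Finset.le_card_sdiff X U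
    omega
  obtain ⟨H, hH, hHc⟩ := Finset.exists_subset_card_eq hle
  refine ⟨H, hH.trans Finset.sdiff_subset, hHc, x0, ?_, ?_, ?_⟩
  · exact (Finset.mem_Icc.mp hx0).1
  · exact (Finset.mem_Icc.mp hx0).2
  · intro y hy u hu hux
    by_contra hcon
    have hy2 := Finset.mem_sdiff.mp (hH hy)
    refine hy2.2 (Finset.mem_filter.mpr ⟨hy2.1, u, ?_, by omega⟩)
    have hb := Finset.mem_Icc.mp hx0
    simp only [hC, S', Finset.mem_filter, Set.Finite.mem_toFinset, hS, Set.mem_ofPred_eq]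
    refine ⟨⟨⟨hu, ?_⟩, ?_⟩, hux⟩
    · omega
    · rw [hux]; exact hx0

theorem sched (N : ℕ) (E : ℕ → Finset (ℤ × ℤ))
    (hm : ∀ a b, a ≤ b → b ≤ N → E a ⊆ E b) (hc : ∀ T ≤ N, (E T).card ≤ 3 * T) :
    ∃ D : ℕ → Finset (ℤ × ℤ), D 0 = ∅ ∧ (∀ t, (D (t + 1) \ D t).card ≤ 3) ∧
      (∀ t, D t ⊆ D (t + 1)) ∧ (∀ t, D t ⊆ E N) ∧ ∀ T ≤ N, E T ⊆ D T := by
  classical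
  have hτ : ∀ w ∈ E N, ∃ T, w ∈ E T := fun w hw => ⟨N, hw⟩
  let τ : ℤ × ℤ → ℕ := fun w => sInf {T | w ∈ E T}
  let key : ℤ × ℤ → ℕ ×ₗ (ℤ ×ₗ ℤ) := fun w => toLex (τ w, toLex w)
  have hkey : Function.Injective key := by
    intro a b hab
    have := congrArg (fun z => (ofLex z).2) hab
    simpa [key] using this
  let rk : ℤ × ℤ → ℕ := fun w => ((E N).filter (fun z => key z < key w)).card
  have hrk : ∀ a ∈ E N, ∀ b, key a < key b → rk a < rk b := by
    intro a ha b hab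
    apply Finset.card_lt_card
    rw [Finset.ssubset_iff_of_subset]
    · exact ⟨a, by simp [ha, hab], by simp⟩
    · intro z hz
      simp only [Finset.mem_filter] at hz ⊢
      exact ⟨hz.1, hz.2.trans hab⟩
  have hinj : Set.InjOn rk (E N) := by
    intro a ha b hb hab
    rcases lt_trichotomy (key a) (key b) with h | h | h
    · have := hrk a ha b h; omega
    · exact hkey h
    · have := hrk b hb a h; omega
  refine ⟨fun t => (E N).filter (fun w => rk w < 3 * t), by simp, ?_, ?_, ?_, ?_⟩
  · intro t
    have : (Finset.Ico (3 * t) (3 * t + 3)).card = 3 := by simp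
    refine le_trans ?_ this.le
    refine Finset.card_le_card_of_injOn rk ?_ ?_
    · intro w hw
      simp only [Finset.coe_sdiff, Finset.coe_filter, Set.mem_sdiff, Set.mem_ofPred_eq, not_and,
        not_lt, Finset.coe_Ico, Set.mem_Ico] at hw ⊢
      have := hw.2 hw.1.1
      omega
    · refine hinj.mono ?_
      intro w hw
      simp only [Finset.coe_sdiff, Finset.coe_filter, Set.mem_sdiff, Set.mem_ofPred_eq] at hw
      exact hw.1.1
  · intro t w hw
    simp only [Finset.mem_filter] at hw ⊢
    exact ⟨hw.1, by omega⟩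
  · intro t
    exact Finset.filter_subset _ _
  · intro T hT w hw
    have hwN : w ∈ E N := hm T N hT le_rfl hw
    simp only [Finset.mem_filter]
    refine ⟨hwN, lt_of_lt_of_le ?_ (hc T hT)⟩
    apply Finset.card_lt_card
    have hτw : τ w ≤ T := Nat.sInf_le hw
    rw [Finset.ssubset_iff_of_subset]
    · exact ⟨w, hw, by simp⟩
    · intro z hz
      simp only [Finset.mem_filter] at hz
      have hz1 : z ∈ E (τ z) := Nat.sInf_mem (s := {T | z ∈ E T}) ⟨N, hz.1⟩
      have hz2 : τ z ≤ τ w := by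
        have := Prod.Lex.lt_iff.mp hz.2
        simp only [key, ofLex_toLex] at this
        rcases this with h | h
        · exact h.le
        · exact h.1.le
      exact hm _ _ (hz2.trans hτw) hT hz1

/-- The parameters of the container strategy. -/
structure Par where
  ρ : ℕ
  h : ℕ
  s : ℕ
  t1 : ℕ
  K : ℕ
  r : ℕ
  s' : ℕ
  t2 : ℕ
  K' : ℕ
  l : ℕ
  d : ℕ
  U : Finset ℤ
  U' : Finset ℤ
  hh : h = 3 * ρ + 1
  hs : s = h + 3 * ρ + 1
  hr : r = ρ + t1 + K
  hs' : s' = r + s + h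
  hl : l = ρ + t2 + K'
  hd : d = 2 * l + s' + r + 1
  h1 : h ≤ ρ + t1
  h2 : r + s ≤ ρ + t2
  hst : 2 * s ≤ t1
  hst' : 2 * s' ≤ t2
  hU : U ⊆ Finset.Icc (-((r : ℤ) + s)) ((h : ℤ) - 1)
  hU' : U' ⊆ Finset.Icc (-((l : ℤ) + s')) ((h : ℤ) - 1)
  hUc : U.card = K + 2 * s
  hUc' : U'.card = K' + 2 * s'

/-- A horizontal segment. -/
def hor (I : Finset ℤ) (y : ℤ) : Finset (ℤ × ℤ) := I.image (fun x => (x, y))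
/-- A vertical segment. -/
def ver (x : ℤ) (I : Finset ℤ) : Finset (ℤ × ℤ) := I.image (fun y => (x, y))

theorem mem_hor {I : Finset ℤ} {y : ℤ} {p : ℤ × ℤ} : p ∈ hor I y ↔ p.1 ∈ I ∧ p.2 = y := by
  unfold hor
  rw [Finset.mem_image]
  constructor
  · rintro ⟨x, hx, rfl⟩; exact ⟨hx, rfl⟩
  · rintro ⟨hx, rfl⟩; exact ⟨p.1, hx, rfl⟩

theorem mem_ver {I : Finset ℤ} {x : ℤ} {p : ℤ × ℤ} : p ∈ ver x I ↔ p.1 = x ∧ p.2 ∈ I := by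
  unfold ver
  rw [Finset.mem_image]
  constructor
  · rintro ⟨x, hx, rfl⟩; exact ⟨rfl, hx⟩
  · rintro ⟨rfl, hx⟩; exact ⟨p.2, hx, rfl⟩

theorem card_hor (I : Finset ℤ) (y : ℤ) : (hor I y).card ≤ I.card := Finset.card_image_le
theorem card_ver (I : Finset ℤ) (y : ℤ) : (ver y I).card ≤ I.card := Finset.card_image_le

/-- Deadlines of phase 1. -/
noncomputable def Par.E1 (P : Par) (T : ℕ) : Finset (ℤ × ℤ) :=
  (if P.h ≤ P.ρ + T then hor (Finset.Icc (-((P.ρ : ℤ) + T)) ((P.ρ : ℤ) + T)) P.h else ∅) ∪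
  (if P.t1 ≤ T then ver P.r (Finset.Icc (-((P.r : ℤ) + P.s)) ((P.h : ℤ) - 1) \ P.U) else ∅)

/-- Deadlines of phase 2. -/
noncomputable def Par.E2 (P : Par) (H : Finset ℤ) (T : ℕ) : Finset (ℤ × ℤ) :=
  hor (Finset.Icc (-((P.ρ : ℤ) + P.t1 + T)) (-((P.ρ : ℤ) + P.t1) - 1)) P.h ∪
  hor (Finset.Icc ((P.ρ : ℤ) + P.t1 + 1) (min ((P.ρ : ℤ) + P.t1 + T) P.r)) P.h ∪
  (if P.K ≤ T then ver P.r (P.U \ H) else ∅) ∪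
  (if P.K + P.s ≤ T then ver P.r H else ∅) ∪
  ver P.r (Finset.Icc (-((P.ρ : ℤ) + P.t1 + T)) (-((P.r : ℤ) + P.s) - 1)) ∪
  (if P.t2 - P.t1 ≤ T then
    ver (-(P.l : ℤ)) (Finset.Icc (-((P.l : ℤ) + P.s')) ((P.h : ℤ) - 1) \ P.U') else ∅)

/-- Deadlines of phase 3. -/
noncomputable def Par.E3 (P : Par) (H : Finset ℤ) (T : ℕ) : Finset (ℤ × ℤ) :=
  hor (Finset.Icc (max (-(P.l : ℤ)) (-((P.ρ : ℤ) + P.t2 + T))) (-((P.ρ : ℤ) + P.t2) - 1)) P.h ∪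
  ver P.r (Finset.Icc (-((P.ρ : ℤ) + P.t2 + T)) (-((P.ρ : ℤ) + P.t2) - 1)) ∪
  (if P.K' ≤ T then ver (-(P.l : ℤ)) (P.U' \ H) else ∅) ∪
  (if P.K' + P.s' ≤ T then ver (-(P.l : ℤ)) H else ∅) ∪
  ver (-(P.l : ℤ)) (Finset.Icc (-((P.ρ : ℤ) + P.t2 + T)) (-((P.l : ℤ) + P.s') - 1)) ∪
  (if P.d - (P.ρ + P.t2) ≤ T then hor (Finset.Icc (-(P.l : ℤ)) P.r) (-(P.d : ℤ)) else ∅)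

theorem mem_ite_empty {α : Type*} {p : Prop} [Decidable p] {A : Finset α} {x : α} :
    x ∈ (if p then A else ∅) ↔ p ∧ x ∈ A := by
  split_ifs with h <;> simp [h]

theorem Par.mem_E1 {P : Par} {T : ℕ} {p : ℤ × ℤ} : p ∈ P.E1 T ↔
    (P.h ≤ P.ρ + T ∧ (-((P.ρ : ℤ) + T) ≤ p.1 ∧ p.1 ≤ (P.ρ : ℤ) + T) ∧ p.2 = P.h) ∨
    (P.t1 ≤ T ∧ p.1 = P.r ∧ (-((P.r : ℤ) + P.s) ≤ p.2 ∧ p.2 ≤ (P.h : ℤ) - 1) ∧ p.2 ∉ P.U) := by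
  simp only [Par.E1, Finset.mem_union, mem_ite_empty, mem_hor, mem_ver, Finset.mem_Icc,
    Finset.mem_sdiff]

theorem Par.mem_E2 {P : Par} {H : Finset ℤ} {T : ℕ} {p : ℤ × ℤ} : p ∈ P.E2 H T ↔
    (((((((-((P.ρ : ℤ) + P.t1 + T) ≤ p.1 ∧ p.1 ≤ -((P.ρ : ℤ) + P.t1) - 1) ∧ p.2 = P.h) ∨
    ((P.ρ : ℤ) + P.t1 + 1 ≤ p.1 ∧ p.1 ≤ min ((P.ρ : ℤ) + P.t1 + T) P.r) ∧ p.2 = P.h) ∨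
    (P.K ≤ T ∧ p.1 = P.r ∧ p.2 ∈ P.U ∧ p.2 ∉ H)) ∨
    (P.K + P.s ≤ T ∧ p.1 = P.r ∧ p.2 ∈ H)) ∨
    (p.1 = P.r ∧ -((P.ρ : ℤ) + P.t1 + T) ≤ p.2 ∧ p.2 ≤ -((P.r : ℤ) + P.s) - 1)) ∨
    (P.t2 - P.t1 ≤ T ∧ p.1 = -(P.l : ℤ) ∧
      (-((P.l : ℤ) + P.s') ≤ p.2 ∧ p.2 ≤ (P.h : ℤ) - 1) ∧ p.2 ∉ P.U')) := by
  simp only [Par.E2, Finset.mem_union, mem_ite_empty, mem_hor, mem_ver, Finset.mem_Icc,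
    Finset.mem_sdiff]

theorem Par.mem_E3 {P : Par} {H : Finset ℤ} {T : ℕ} {p : ℤ × ℤ} : p ∈ P.E3 H T ↔
    (((((((max (-(P.l : ℤ)) (-((P.ρ : ℤ) + P.t2 + T)) ≤ p.1 ∧
      p.1 ≤ -((P.ρ : ℤ) + P.t2) - 1) ∧ p.2 = P.h) ∨
    (p.1 = P.r ∧ -((P.ρ : ℤ) + P.t2 + T) ≤ p.2 ∧ p.2 ≤ -((P.ρ : ℤ) + P.t2) - 1)) ∨
    (P.K' ≤ T ∧ p.1 = -(P.l : ℤ) ∧ p.2 ∈ P.U' ∧ p.2 ∉ H)) ∨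
    (P.K' + P.s' ≤ T ∧ p.1 = -(P.l : ℤ) ∧ p.2 ∈ H)) ∨
    (p.1 = -(P.l : ℤ) ∧ -((P.ρ : ℤ) + P.t2 + T) ≤ p.2 ∧ p.2 ≤ -((P.l : ℤ) + P.s') - 1)) ∨
    (P.d - (P.ρ + P.t2) ≤ T ∧ (-(P.l : ℤ) ≤ p.1 ∧ p.1 ≤ P.r) ∧ p.2 = -(P.d : ℤ))) := by
  simp only [Par.E3, Finset.mem_union, mem_ite_empty, mem_hor, mem_ver, Finset.mem_Icc,
    Finset.mem_sdiff]

theorem Par.E1_mono (P : Par) {a b : ℕ} (hab : a ≤ b) : P.E1 a ⊆ P.E1 b := by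
  intro p hp
  rw [Par.mem_E1] at hp ⊢
  rcases hp with hp | hp
  · left; omega
  · right; exact ⟨by omega, hp.2⟩

theorem Par.E2_mono (P : Par) (H : Finset ℤ) {a b : ℕ} (hab : a ≤ b) :
    P.E2 H a ⊆ P.E2 H b := by
  intro p hp
  rw [Par.mem_E2] at hp ⊢
  rcases hp with ((((hp | hp) | hp) | hp) | hp) | hp
  · iterate 5 left
    omega
  · iterate 4 left
    right; omega
  · iterate 3 left
    right; exact ⟨by omega, hp.2⟩
  · iterate 2 left
    right; exact ⟨by omega, hp.2⟩
  · left; right; omega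
  · right; exact ⟨by omega, hp.2⟩

theorem Par.E3_mono (P : Par) (H : Finset ℤ) {a b : ℕ} (hab : a ≤ b) :
    P.E3 H a ⊆ P.E3 H b := by
  intro p hp
  rw [Par.mem_E3] at hp ⊢
  rcases hp with ((((hp | hp) | hp) | hp) | hp) | hp
  · iterate 5 left
    omega
  · iterate 4 left
    right; omega
  · iterate 3 left
    right; exact ⟨by omega, hp.2⟩
  · iterate 2 left
    right; exact ⟨by omega, hp.2⟩
  · left; right; omega
  · right; exact ⟨by omega, hp.2⟩

theorem card_ite_le {α : Type*} {p : Prop} [Decidable p] {A : Finset α} {n : ℕ}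
    (h : A.card ≤ n) : (if p then A else ∅).card ≤ if p then n else 0 := by
  split_ifs <;> simp [h]

theorem card_union_le' {α : Type*} [DecidableEq α] {A B : Finset α} {m n : ℕ}
    (h : A.card ≤ m) (h' : B.card ≤ n) : (A ∪ B).card ≤ m + n :=
  (Finset.card_union_le A B).trans (add_le_add h h')

theorem Par.E1_card (P : Par) {T : ℕ} (hT : T ≤ P.t1) : (P.E1 T).card ≤ 3 * T := by
  refine (card_union_le' (card_ite_le (card_hor _ _)) (card_ite_le (card_ver _ _))).trans ?_
  rw [Finset.card_sdiff_of_subset P.hU, P.hUc, Int.card_Icc, Int.card_Icc]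
  obtain ⟨ρ, h, s, t1, K, r, s', t2, K', l, d, U, U', hh, hs, hr, hs', hl, hd, h1, h2, hst, hst', hU, hU', hUc, hUc'⟩ := P
  simp only at *
  split_ifs <;> omega

theorem Par.E2_card (P : Par) {H : Finset ℤ} (hH : H ⊆ P.U) (hHc : H.card = 2 * P.s) {T : ℕ}
    (hT : T ≤ P.t2 - P.t1) : (P.E2 H T).card ≤ 3 * T := by
  refine (card_union_le' (card_union_le' (card_union_le' (card_union_le' (card_union_le'
    (card_hor _ _) (card_hor _ _)) (card_ite_le (card_ver _ _))) (card_ite_le (card_ver _ _)))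
    (card_ver _ _)) (card_ite_le (card_ver _ _))).trans ?_
  rw [Finset.card_sdiff_of_subset P.hU', P.hUc', Finset.card_sdiff_of_subset hH, hHc, P.hUc]
  simp only [Int.card_Icc]
  clear hH hHc
  obtain ⟨ρ, h, s, t1, K, r, s', t2, K', l, d, U, U', hh, hs, hr, hs', hl, hd, h1, h2, hst, hst', hU, hU', hUc, hUc'⟩ := P
  simp only at *
  split_ifs <;> omega

theorem Par.E3_card (P : Par) {H : Finset ℤ} (hH : H ⊆ P.U') (hHc : H.card = 2 * P.s') {T : ℕ}
    (hT : T ≤ P.d - (P.ρ + P.t2)) : (P.E3 H T).card ≤ 3 * T := by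
  refine (card_union_le' (card_union_le' (card_union_le' (card_union_le' (card_union_le'
    (card_hor _ _) (card_ver _ _)) (card_ite_le (card_ver _ _))) (card_ite_le (card_ver _ _)))
    (card_ver _ _)) (card_ite_le (card_hor _ _))).trans ?_
  rw [Finset.card_sdiff_of_subset hH, hHc, P.hUc']
  simp only [Int.card_Icc]
  clear hH hHc
  obtain ⟨ρ, h, s, t1, K, r, s', t2, K', l, d, U, U', hh, hs, hr, hs', hl, hd, h1, h2, hst, hst', hU, hU', hUc, hUc'⟩ := P
  simp only at *
  split_ifs <;> omega

/-- The boundary of the box. -/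
def Par.Wall (P : Par) (p : ℤ × ℤ) : Prop :=
  (-(P.l : ℤ) ≤ p.1 ∧ p.1 ≤ P.r ∧ -(P.d : ℤ) ≤ p.2 ∧ p.2 ≤ P.h) ∧
  (p.1 = -(P.l : ℤ) ∨ p.1 = P.r ∨ p.2 = -(P.d : ℤ) ∨ p.2 = P.h)

theorem Par.E1_wall (P : Par) {p : ℤ × ℤ} (hp : p ∈ P.E1 P.t1) : P.Wall p := by
  rw [Par.mem_E1] at hp
  obtain ⟨ρ, h, s, t1, K, r, s', t2, K', l, d, U, U', hh, hs, hr, hs', hl, hd, h1, h2, hst, hst', hU, hU', hUc, hUc'⟩ := P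
  simp only [Par.Wall] at *
  omega

theorem Par.E2_wall (P : Par) {H : Finset ℤ} (hH : H ⊆ P.U) {p : ℤ × ℤ}
    (hp : p ∈ P.E2 H (P.t2 - P.t1)) : P.Wall p := by
  have hU : p.2 ∈ P.U → _ := fun h => Finset.mem_Icc.mp (P.hU h)
  have hU2 : p.2 ∈ H → _ := fun h => Finset.mem_Icc.mp (P.hU (hH h))
  rw [Par.mem_E2] at hp
  clear hH
  obtain ⟨ρ, h, s, t1, K, r, s', t2, K', l, d, U, U', hh, hs, hr, hs', hl, hd, h1, h2, hst, hst', hU, hU', hUc, hUc'⟩ := P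
  simp only [Par.Wall] at *
  rcases hp with ((((hp | hp) | hp) | hp) | hp) | hp
  · omega
  · omega
  · have := hU hp.2.2.1; omega
  · have := hU2 hp.2.2; omega
  · omega
  · omega

theorem Par.E3_wall (P : Par) {H : Finset ℤ} (hH : H ⊆ P.U') {p : ℤ × ℤ}
    (hp : p ∈ P.E3 H (P.d - (P.ρ + P.t2))) : P.Wall p := by
  have hU : p.2 ∈ P.U' → _ := fun h => Finset.mem_Icc.mp (P.hU' h)
  have hU2 : p.2 ∈ H → _ := fun h => Finset.mem_Icc.mp (P.hU' (hH h))
  rw [Par.mem_E3] at hp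
  clear hH
  obtain ⟨ρ, h, s, t1, K, r, s', t2, K', l, d, U, U', hh, hs, hr, hs', hl, hd, h1, h2, hst, hst', hU, hU', hUc, hUc'⟩ := P
  simp only [Par.Wall] at *
  rcases hp with ((((hp | hp) | hp) | hp) | hp) | hp
  · omega
  · omega
  · have := hU hp.2.2.1; omega
  · have := hU2 hp.2.2; omega
  · omega
  · omega

set_option maxHeartbeats 4000000 in
theorem Par.safe (P : Par) (B Δ : ℕ → Set (ℤ × ℤ)) (H H' : Finset ℤ)
    (hD1 : ∀ T ≤ P.t1, ∀ t, T ≤ t → ∀ p ∈ P.E1 T, p ∈ Δ t)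
    (hD2 : ∀ T ≤ P.t2 - P.t1, ∀ t, P.t1 + T ≤ t → ∀ p ∈ P.E2 H T, p ∈ Δ t)
    (hD3 : ∀ T ≤ P.d - (P.ρ + P.t2), ∀ t, P.t2 + T ≤ t → ∀ p ∈ P.E3 H' T, p ∈ Δ t)
    (hS : ∀ y ∈ H, ∀ t < P.t1 + P.K + P.s, ((P.r : ℤ), y) ∉ B t)
    (hS' : ∀ y ∈ H', ∀ t < P.t2 + P.K' + P.s', (-(P.l : ℤ), y) ∉ B t)
    (p : ℤ × ℤ) (t : ℕ) (hw : P.Wall p) (hp1 : |p.1| ≤ (P.ρ : ℤ) + t)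
    (hp2 : |p.2| ≤ (P.ρ : ℤ) + t) (hB : p ∈ B t) : p ∈ Δ t := by
  have hSp : p.1 = P.r → p.2 ∈ H → P.t1 + P.K + P.s ≤ t := by
    intro h1 h2
    by_contra hcon
    exact hS p.2 h2 t (by omega) (by rw [← h1]; exact hB)
  have hSp' : p.1 = -(P.l : ℤ) → p.2 ∈ H' → P.t2 + P.K' + P.s' ≤ t := by
    intro h1 h2
    by_contra hcon
    exact hS' p.2 h2 t (by omega) (by rw [← h1]; exact hB)
  have hU1 : p.2 ∈ P.U → _ := fun h => Finset.mem_Icc.mp (P.hU h)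
  have hU2 : p.2 ∈ P.U' → _ := fun h => Finset.mem_Icc.mp (P.hU' h)
  clear hS hS' hB
  replace hD1 := fun T hT hTt => hD1 T hT t hTt p
  replace hD2 := fun T hT hTt => hD2 T hT t hTt p
  replace hD3 := fun T hT hTt => hD3 T hT t hTt p
  simp only [Par.mem_E1, Par.mem_E2, Par.mem_E3] at hD1 hD2 hD3
  obtain ⟨ρ, h, s, t1, K, r, s', t2, K', l, d, U, U', hh, hs, hr, hs', hl, hd, h1, h2, hst, hst', hU, hU', hUc, hUc'⟩ := P
  obtain ⟨x, y⟩ := p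
  simp only [Par.Wall, abs_le] at *
  obtain ⟨hbox, hw⟩ := hw
  clear hU hU' hUc hUc'
  by_cases c1 : y = h
  · by_cases c2 : -((ρ : ℤ) + t1) ≤ x ∧ x ≤ (ρ : ℤ) + t1
    · by_cases c3 : t ≤ t1
      · exact hD1 t c3 le_rfl (by omega)
      · exact hD1 t1 le_rfl (by omega) (by omega)
    · by_cases c3 : -((ρ : ℤ) + t2) ≤ x
      · by_cases c4 : t ≤ t2
        · exact hD2 (t - t1) (by omega) (by omega) (by omega)
        · exact hD2 (t2 - t1) (by omega) (by omega) (by omega)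
      · by_cases c4 : t - t2 ≤ d - (ρ + t2)
        · exact hD3 (t - t2) (by omega) (by omega) (by omega)
        · exact hD3 (d - (ρ + t2)) (by omega) (by omega) (by omega)
  · by_cases c2 : y = -(d : ℤ)
    · exact hD3 (d - (ρ + t2)) (by omega) (by omega) (by omega)
    · by_cases c3 : x = r
      · by_cases c4 : -((r : ℤ) + s) ≤ y
        · by_cases c5 : y ∈ U
          · by_cases c6 : y ∈ H
            · have := hSp c3 c6
              exact hD2 (K + s) (by omega) (by omega) (by simp [c3, c6])
            · exact hD2 K (by omega) (by omega) (by simp [c3, c5, c6])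
          · exact hD1 t1 (by omega) (by omega) (Or.inr ⟨le_rfl, c3, by omega, c5⟩)
        · by_cases c5 : -((ρ : ℤ) + t2) ≤ y
          · exact hD2 (min (t - t1) (t2 - t1)) (by omega) (by omega) (by omega)
          · exact hD3 (min (t - t2) (d - (ρ + t2))) (by omega) (by omega) (by omega)
      · have c3' : x = -(l : ℤ) := by omega
        by_cases c4 : -((l : ℤ) + s') ≤ y
        · by_cases c5 : y ∈ U'
          · by_cases c6 : y ∈ H'
            · have := hSp' c3' c6
              exact hD3 (K' + s') (by omega) (by omega) (by simp [c3', c6])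
            · exact hD3 K' (by omega) (by omega) (by simp [c3', c5, c6])
          · exact hD2 (t2 - t1) (by omega) (by omega) (Or.inr ⟨le_rfl, c3', by omega, c5⟩)
        · exact hD3 (min (t - t2) (d - (ρ + t2))) (by omega) (by omega) (by omega)

theorem budget_three (t : ℕ) : budget 3 (t + 1) = 3 := by
  unfold budget
  have h1 : ⌊((t + 1 : ℕ) : ℝ) * 3⌋ = ((t : ℤ) + 1) * 3 := by
    rw [Int.floor_eq_iff]; push_cast; constructor <;> linarith
  have h2 : ⌊(((t + 1 : ℕ) : ℝ) - 1) * 3⌋ = (t : ℤ) * 3 := by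
    rw [Int.floor_eq_iff]; push_cast; constructor <;> linarith
  rw [h1, h2]
  have : ((t : ℤ) + 1) * 3 - t * 3 = 3 := by ring
  rw [this]; rfl

theorem stabilize (B : ℕ → Set (ℤ × ℤ)) (hm : Monotone B) (W : Set (ℤ × ℤ)) (hW : W.Finite)
    (h : ∀ t, B t ⊆ W) : ∃ T : ℕ, ∀ t : ℕ, T ≤ t → B t = B T := by
  have hb : ∀ t, (B t).ncard ≤ W.ncard := fun t => Set.ncard_le_ncard (h t) hW
  have hfin : (Set.range fun t => (B t).ncard).Finite :=
    (Set.finite_Iic W.ncard).subset (by rintro _ ⟨t, rfl⟩; exact hb t)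
  obtain ⟨T, hT⟩ := (hfin.isCompact.exists_isGreatest ⟨_, ⟨0, rfl⟩⟩)
  obtain ⟨⟨T, rfl⟩, hT⟩ := hT
  refine ⟨T, fun t ht => ?_⟩
  exact (Set.eq_of_subset_of_ncard_le (hm ht) (hT ⟨t, rfl⟩) (hW.subset (h t))).symm

theorem delSets_mono {σ : List (Set (ℤ × ℤ)) → Set (ℤ × ℤ)} {B : ℕ → Set (ℤ × ℤ)} :
    Monotone (delSets σ B) :=
  monotone_nat_of_le_succ fun _ => Set.subset_union_left

theorem delSets_phase {σ : List (Set (ℤ × ℤ)) → Set (ℤ × ℤ)} {B : ℕ → Set (ℤ × ℤ)} (a n : ℕ)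
    (D : ℕ → Finset (ℤ × ℤ)) (h0 : D 0 = ∅)
    (h : ∀ k < n, σ ((List.range (a + k + 1)).map B) = ↑(D (k + 1) \ D k)) :
    ∀ k ≤ n, (D k : Set (ℤ × ℤ)) ⊆ delSets σ B (a + k) := by
  intro k
  induction k with
  | zero => intro _; simp [h0]
  | succ k ih =>
    intro hk p hp
    by_cases hpk : p ∈ D k
    · exact Or.inl (ih (by omega) hpk)
    · refine Or.inr ?_
      change p ∈ σ ((List.range (a + k + 1)).map B)
      rw [h k (by omega)]
      simp only [Finset.coe_sdiff, Set.mem_sdiff]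
      exact ⟨hp, hpk⟩

theorem Par.wins (P : Par) (g : ℕ → ℕ∞) (G G' : ℕ) (B₀ : Set (ℤ × ℤ))
    (hB₀ : ∀ v ∈ B₀, |v.1| ≤ (P.ρ : ℤ) ∧ |v.2| ≤ (P.ρ : ℤ))
    (hG : ∀ t < P.t1, g (t + 1) ≤ G) (hG' : ∀ t < P.t2, g (t + 1) ≤ G')
    (hGK : 2 * G ≤ P.K) (hGK' : 2 * G' ≤ P.K')
    (hsp : ∀ y ∈ P.U, ∀ z ∈ P.U, |y - z| ≤ 2 * ((P.K : ℤ) + 3 * P.s) → y = z)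
    (hsp' : ∀ y ∈ P.U', ∀ z ∈ P.U', |y - z| ≤ 2 * ((P.K' : ℤ) + 3 * P.s') → y = z) :
    ContainerWins adjStrong 3 g B₀ := by
  classical
  have key : ∀ (s K : ℕ) (U : Finset ℤ) (_ : U.card = K + 2 * s) (Q : Finset ℤ → Prop),
      ∃ H ⊆ U, H.card = 2 * s ∧ ((∃ H ⊆ U, H.card = 2 * s ∧ Q H) → Q H) := by
    intro s K U hU Q
    by_cases hq : ∃ H ⊆ U, H.card = 2 * s ∧ Q H
    · obtain ⟨H, h1, h2, h3⟩ := hq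
      exact ⟨H, h1, h2, fun _ => h3⟩
    · obtain ⟨H, h1, h2⟩ := Finset.exists_subset_card_eq (s := U) (n := 2 * s) (by omega)
      exact ⟨H, h1, h2, fun h => absurd h hq⟩
  choose H hHU hHc hHg using fun F : Set (ℤ × ℤ) =>
    key P.s P.K P.U P.hUc (fun H => Good P.ρ P.t1 P.K P.s F H)
  choose H' hHU' hHc' hHg' using fun F : Set (ℤ × ℤ) =>
    key P.s' P.K' P.U' P.hUc' (fun H => Good P.ρ P.t2 P.K' P.s' {p | (-p.1, p.2) ∈ F} H)
  obtain ⟨D1, h10, h1c, -, h1s, h1E⟩ := sched P.t1 P.E1 (fun a b hab _ => P.E1_mono hab)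
    (fun T hT => P.E1_card hT)
  choose D2 h20 h2c _ h2s h2E using fun F => sched (P.t2 - P.t1) (P.E2 (H F))
    (fun a b hab _ => P.E2_mono _ hab) (fun T hT => P.E2_card (hHU F) (hHc F) hT)
  choose D3 h30 h3c _ h3s h3E using fun F => sched (P.d - (P.ρ + P.t2)) (P.E3 (H' F))
    (fun a b hab _ => P.E3_mono _ hab) (fun T hT => P.E3_card (hHU' F) (hHc' F) hT)
  have ht12 : P.t1 ≤ P.t2 := by have := P.h2; have := P.hr; omega
  let σ : List (Set (ℤ × ℤ)) → Set (ℤ × ℤ) := fun L =>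
    let t := L.length - 1
    if t < P.t1 then ↑(D1 (t + 1) \ D1 t)
    else if t < P.t2 then
      ↑(D2 (L.getD P.t1 ∅) (t - P.t1 + 1) \ D2 (L.getD P.t1 ∅) (t - P.t1))
    else ↑(D3 (L.getD P.t2 ∅) (t - P.t2 + 1) \ D3 (L.getD P.t2 ∅) (t - P.t2))
  have hσ : ∀ (B : ℕ → Set (ℤ × ℤ)) (t : ℕ), σ ((List.range (t + 1)).map B) =
      if t < P.t1 then ↑(D1 (t + 1) \ D1 t)
      else if t < P.t2 then ↑(D2 (B P.t1) (t - P.t1 + 1) \ D2 (B P.t1) (t - P.t1))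
      else ↑(D3 (B P.t2) (t - P.t2 + 1) \ D3 (B P.t2) (t - P.t2)) := by
    intro B t
    have hget : ∀ i ≤ t, ((List.range (t + 1)).map B).getD i ∅ = B i := by
      intro i hi
      rw [List.getD_eq_getElem _ _ (by simp; omega)]
      simp
    simp only [σ, List.length_map, List.length_range, Nat.add_sub_cancel]
    split_ifs with c1 c2
    · rfl
    · rw [hget _ (by omega)]
    · rw [hget _ (by omega)]
  refine ⟨σ, fun B hB0 hL => ?_⟩
  have hF : Fire P.ρ B := by
    refine ⟨by rw [hB0]; exact hB₀, fun t => (hL t).1, ?_⟩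
    intro t v hv hn
    obtain ⟨-, u, hu, ha⟩ := (hL t).2.2 v ⟨hv, hn⟩
    refine ⟨u, hu, ?_, ?_⟩
    · rw [abs_sub_comm]; exact (le_max_left _ _).trans ha.le
    · rw [abs_sub_comm]; exact (le_max_right _ _).trans ha.le
  have hs0 : 0 < P.s := by have := P.hs; omega
  have hs0' : 0 < P.s' := by have := P.hs'; omega
  have good1 : Good P.ρ P.t1 P.K P.s (B P.t1) (H (B P.t1)) :=
    hHg _ (good_exists hF P.hst hs0 (fun t ht => ((hL t).2.1).trans (hG t ht)) hGK P.U P.hUc hsp)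
  have good2 : Good P.ρ P.t2 P.K' P.s' {p | (-p.1, p.2) ∈ B P.t2} (H' (B P.t2)) := by
    refine hHg' _ (good_exists hF.reflect P.hst' hs0' (fun t ht => ?_) hGK' P.U' P.hUc' hsp')
    refine le_trans ?_ (((hL t).2.1).trans (hG' t ht))
    have hinj : Function.Injective (fun p : ℤ × ℤ => (-p.1, p.2)) := by
      rintro ⟨a, b⟩ ⟨c, d⟩ h
      simpa using h
    rw [← hinj.encard_image]
    apply Set.encard_le_encard
    rintro _ ⟨p, ⟨hp1, hp2⟩, rfl⟩
    exact ⟨hp1, hp2⟩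
  have hD1 : ∀ T ≤ P.t1, ∀ t, T ≤ t → ∀ p ∈ P.E1 T, p ∈ delSets σ B t := by
    intro T hT t ht p hp
    have := delSets_phase (σ := σ) (B := B) 0 P.t1 D1 h10 (by
      intro k hk
      rw [hσ, if_pos (by omega)]
      simp) T hT
    exact delSets_mono (by omega) (this (h1E T hT hp))
  have hD2 : ∀ T ≤ P.t2 - P.t1, ∀ t, P.t1 + T ≤ t → ∀ p ∈ P.E2 (H (B P.t1)) T,
      p ∈ delSets σ B t := by
    intro T hT t ht p hp
    have := delSets_phase (σ := σ) (B := B) P.t1 (P.t2 - P.t1) (D2 (B P.t1)) (h20 _) (by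
      intro k hk
      rw [hσ, if_neg (by omega), if_pos (by omega)]
      simp) T hT
    exact delSets_mono ht (this (h2E _ T hT hp))
  have hD3 : ∀ T ≤ P.d - (P.ρ + P.t2), ∀ t, P.t2 + T ≤ t → ∀ p ∈ P.E3 (H' (B P.t2)) T,
      p ∈ delSets σ B t := by
    intro T hT t ht p hp
    have := delSets_phase (σ := σ) (B := B) P.t2 (P.d - (P.ρ + P.t2)) (D3 (B P.t2)) (h30 _) (by
      intro k hk
      rw [hσ, if_neg (by omega), if_neg (by omega)]
      simp) T hT
    exact delSets_mono ht (this (h3E _ T hT hp))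
  have hsafe := P.safe B (delSets σ B) _ _ hD1 hD2 hD3
    (fun y hy t ht => by
      have := good_safe hF P.hst good1 hy ht
      rwa [← P.hr] at this)
    (fun y hy t ht => by
      have := good_safe hF.reflect P.hst' good2 hy ht
      rw [← P.hl] at this
      exact this)
  have hWall : ∀ p, P.Wall p → ∀ t, p ∉ B t := by
    intro p hp t
    induction t with
    | zero =>
      intro hv
      have hi := hF.init p hv
      have e1 := P.hh
      have e2 := P.hr
      have e3 := P.hl
      have e4 := P.hd
      have e5 := P.h1
      have e6 := P.h2
      have e7 := P.hst
      have e8 := P.hs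
      simp only [Par.Wall, abs_le] at hp hi
      omega
    | succ t ih =>
      intro hv
      have hr := hF.reach (t + 1) p hv
      exact ((hL t).2.2 p ⟨hv, ih⟩).1 (hsafe p (t + 1) hp hr.1 hr.2 hv)
  have hσW : ∀ t, ∀ p ∈ σ ((List.range (t + 1)).map B), P.Wall p := by
    intro t p hp
    rw [hσ] at hp
    split_ifs at hp
    · exact P.E1_wall (h1s _ (Finset.mem_sdiff.mp hp).1)
    · exact P.E2_wall (hHU _) (h2s _ _ (Finset.mem_sdiff.mp hp).1)
    · exact P.E3_wall (hHU' _) (h3s _ _ (Finset.mem_sdiff.mp hp).1)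
  have hin : ∀ t, ∀ p ∈ B t, -(P.l : ℤ) ≤ p.1 ∧ p.1 ≤ P.r ∧ -(P.d : ℤ) ≤ p.2 ∧ p.2 ≤ P.h := by
    intro t
    induction t with
    | zero =>
      intro p hv
      have hi := hF.init p hv
      have e1 := P.hh
      have e2 := P.hr
      have e3 := P.hl
      have e4 := P.hd
      have e5 := P.h1
      have e6 := P.h2
      simp only [abs_le] at hi
      omega
    | succ t ih =>
      intro v hv
      by_cases hvt : v ∈ B t
      · exact ih v hvt
      · obtain ⟨u, hu, h1, h2⟩ := hF.step t v hv hvt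
        have hb := ih u hu
        have hn : ¬ P.Wall u := fun h => hWall u h t hu
        simp only [Par.Wall, abs_le] at hn h1 h2
        omega
  refine ⟨fun t => ⟨?_, ?_⟩, fun _ => Set.subset_univ _, ?_⟩
  · ext p
    simp only [Set.mem_inter_iff, Set.mem_empty_iff_false, iff_false, not_and]
    exact fun hp => hWall p (hσW t p hp) t
  · rw [budget_three, hσ]
    split_ifs
    · rw [Set.encard_coe_eq_coe_finsetCard]; exact_mod_cast h1c _
    · rw [Set.encard_coe_eq_coe_finsetCard]; exact_mod_cast h2c _ _
    · rw [Set.encard_coe_eq_coe_finsetCard]; exact_mod_cast h3c _ _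
  · refine stabilize B hF.monotone
      (Set.Icc (-(P.l : ℤ)) P.r ×ˢ Set.Icc (-(P.d : ℤ)) P.h)
      ((Set.finite_Icc _ _).prod (Set.finite_Icc _ _)) ?_
    intro t p hp
    have := hin t p hp
    exact ⟨⟨this.1, this.2.1⟩, this.2.2.1, this.2.2.2⟩

/-- Evenly spaced holes. -/
theorem holes_exist (K s r h : ℕ) (hfit : (K + 2 * s) * (2 * K + 6 * s + 1) ≤ r) :
    ∃ U : Finset ℤ, U ⊆ Finset.Icc (-((r : ℤ) + s)) ((h : ℤ) - 1) ∧ U.card = K + 2 * s ∧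
      ∀ y ∈ U, ∀ z ∈ U, |y - z| ≤ 2 * ((K : ℤ) + 3 * s) → y = z := by
  have hinj : Function.Injective
      (fun i : ℕ => (h : ℤ) - 1 - (i : ℤ) * (2 * K + 6 * s + 1)) := by
    intro a b hab
    have h1 : (a : ℤ) * (2 * K + 6 * s + 1) = (b : ℤ) * (2 * K + 6 * s + 1) := by
      simp only at hab; linarith
    have := mul_right_cancel₀ (by positivity) h1
    exact_mod_cast this
  refine ⟨(Finset.range (K + 2 * s)).image
    (fun i : ℕ => (h : ℤ) - 1 - (i : ℤ) * (2 * K + 6 * s + 1)), ?_, ?_, ?_⟩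
  · intro y hy
    obtain ⟨i, hi, rfl⟩ := Finset.mem_image.mp hy
    have hi := Finset.mem_range.mp hi
    have h1 : (i + 1) * (2 * K + 6 * s + 1) ≤ r :=
      (Nat.mul_le_mul_right _ hi).trans hfit
    have h2 : ((i : ℤ) + 1) * (2 * K + 6 * s + 1) ≤ r := by exact_mod_cast h1
    rw [Finset.mem_Icc]
    constructor
    · nlinarith
    · have : 0 ≤ (i : ℤ) * (2 * K + 6 * s + 1) := by positivity
      linarith
  · rw [Finset.card_image_of_injective _ hinj, Finset.card_range]
  · intro y hy z hz hyz
    obtain ⟨i, hi, rfl⟩ := Finset.mem_image.mp hy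
    obtain ⟨j, hj, rfl⟩ := Finset.mem_image.mp hz
    rw [abs_le] at hyz
    have hij : i = j := by
      rcases lt_trichotomy i j with h | h | h
      · exfalso
        have h' : (i : ℤ) + 1 ≤ j := by exact_mod_cast h
        have : ((i : ℤ) + 1) * (2 * K + 6 * s + 1) ≤ j * (2 * K + 6 * s + 1) :=
          mul_le_mul_of_nonneg_right h' (by positivity)
        nlinarith
      · exact h
      · exfalso
        have h' : (j : ℤ) + 1 ≤ i := by exact_mod_cast h
        have : ((j : ℤ) + 1) * (2 * K + 6 * s + 1) ≤ i * (2 * K + 6 * s + 1) :=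
          mul_le_mul_of_nonneg_right h' (by positivity)
        nlinarith
    rw [hij]

theorem g_bound (c : ℝ) (hc0 : 0 < c) (hc : c < 1 / 6) (n t : ℕ) (ht : t ≤ 9 * n ^ 2) :
    ((⌈c * Real.sqrt (t : ℝ)⌉₊ : ℕ) : ℕ∞) ≤ (((n + 1) / 2 : ℕ) : ℕ∞) := by
  have h1 : Real.sqrt (t : ℝ) ≤ 3 * n := by
    apply Real.sqrt_le_iff.mpr
    refine ⟨by positivity, ?_⟩
    have : (t : ℝ) ≤ 9 * (n : ℝ) ^ 2 := by exact_mod_cast ht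
    nlinarith
  have h2 : ⌈c * Real.sqrt (t : ℝ)⌉₊ ≤ (n + 1) / 2 := by
    rw [Nat.ceil_le]
    have h3 : n ≤ 2 * ((n + 1) / 2) := by omega
    have h4 : (n : ℝ) ≤ 2 * (((n + 1) / 2 : ℕ) : ℝ) := by exact_mod_cast h3
    have h5 : c * Real.sqrt (t : ℝ) ≤ 1 / 6 * (3 * n) :=
      mul_le_mul hc.le h1 (Real.sqrt_nonneg _) (by norm_num)
    linarith
  exact_mod_cast h2

theorem wins_sqrt (c : ℝ) (hc0 : 0 < c) (hc : c < 1 / 6) (B₀ : Set (ℤ × ℤ)) (hB : B₀.Finite) :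
    ContainerWins adjStrong 3 (fun t => (⌈c * Real.sqrt (t : ℝ)⌉₊ : ℕ∞)) B₀ := by
  obtain ⟨ρ, hρ⟩ : ∃ ρ : ℕ, ∀ v ∈ B₀, |v.1| ≤ (ρ : ℤ) ∧ |v.2| ≤ (ρ : ℤ) := by
    have hb := (hB.image (fun v : ℤ × ℤ => v.1.natAbs + v.2.natAbs)).bddAbove
    obtain ⟨m, hm⟩ := hb
    refine ⟨m, fun v hv => ?_⟩
    have : v.1.natAbs + v.2.natAbs ≤ m := hm ⟨v, hv, rfl⟩
    simp only [abs_le]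
    omega
  obtain ⟨h, hh⟩ : ∃ h, h = 3 * ρ + 1 := ⟨_, rfl⟩
  obtain ⟨s, hs⟩ : ∃ s, s = h + 3 * ρ + 1 := ⟨_, rfl⟩
  have fit : ∀ s : ℕ, 1 ≤ s → ((10 * s + 1) + 2 * s) * (2 * (10 * s + 1) + 6 * s + 1) ≤
      9 * (10 * s) ^ 2 := by
    intro s hs
    nlinarith
  have big : ∀ s : ℕ, 1 ≤ s → 900 * s ≤ 9 * (10 * s) ^ 2 := by
    intro s hs
    nlinarith
  obtain ⟨r, hr⟩ : ∃ r, r = 9 * (10 * s) ^ 2 := ⟨_, rfl⟩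
  obtain ⟨s', hs'⟩ : ∃ s', s' = r + s + h := ⟨_, rfl⟩
  obtain ⟨l, hl⟩ : ∃ l, l = 9 * (10 * s') ^ 2 := ⟨_, rfl⟩
  have br := big s (by omega)
  have bl := big s' (by omega)
  rw [← hr] at br
  rw [← hl] at bl
  obtain ⟨U, hU, hUc, hsp⟩ := holes_exist (10 * s + 1) s r h (by rw [hr]; exact fit s (by omega))
  obtain ⟨U', hU', hUc', hsp'⟩ :=
    holes_exist (10 * s' + 1) s' l h (by rw [hl]; exact fit s' (by omega))
  let P : Par :=
    { ρ := ρ, h := h, s := s, t1 := r - (10 * s + 1) - ρ, K := 10 * s + 1, r := r, s' := s'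
      t2 := l - (10 * s' + 1) - ρ, K' := 10 * s' + 1, l := l, d := 2 * l + s' + r + 1
      U := U, U' := U', hh := hh, hs := hs, hr := by omega, hs' := hs', hl := by omega, hd := rfl
      h1 := by omega, h2 := by omega, hst := by omega, hst' := by omega
      hU := hU, hU' := hU', hUc := hUc, hUc' := hUc' }
  refine P.wins _ ((10 * s + 1) / 2) ((10 * s' + 1) / 2) B₀ hρ ?_ ?_ ?_ ?_ hsp hsp'
  · intro t ht
    refine g_bound c hc0 hc (10 * s) (t + 1) ?_
    have : t < r - (10 * s + 1) - ρ := ht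
    rw [← hr]; omega
  · intro t ht
    refine g_bound c hc0 hc (10 * s') (t + 1) ?_
    have : t < l - (10 * s' + 1) - ρ := ht
    rw [← hl]; omega
  · change 2 * ((10 * s + 1) / 2) ≤ 10 * s + 1
    omega
  · change 2 * ((10 * s' + 1) / 2) ≤ 10 * s' + 1
    omega

/-- **Proposition.** For every `0 < c < 1/6`, Container of strength `q = 3` wins the
containment game on `Z_strong` with spreading function `g(t) = ⌈c·√t⌉` from every
finite initial occupied set; that is, `3 ∈ q(Z_strong, t ↦ ⌈c·t^{1/2}⌉)`. -/
theorem three_in_qSet_strong_sqrt (c : ℝ) (hc0 : 0 < c) (hc : c < 1 / 6) :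
    (3 : ℝ) ∈ qSet adjStrong (fun t => (⌈c * Real.sqrt (t : ℝ)⌉₊ : ℕ∞)) := by
  exact ⟨by norm_num, fun B₀ hB => wins_sqrt c hc0 hc B₀ hB⟩
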